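/- Let (f⁺, f⁻) be a Vickrey queue flow for an arc with transit time τ > 0 and capacity ν > 0. Then the exit time function T(θ) := θ + τ + z(θ + τ)/ν is nondecreasing on [0, ∞); i.e., flow particles traverse the arc in first-in-first-out order. -/

import Mathlib

open MeasureTheory

/-- The cumulative function `F(θ) = ∫₀^θ f(ξ) dξ` of a rate function `f`. -/
noncomputable def cumul (f : ℝ → ℝ) (θ : ℝ) : ℝ := ∫ ξ in (0:ℝ)..θ, f ξ

/-- A Vickrey queue flow for an arc with transit time `τ` and capacity `ν`: a pair
`(fi, fo)` of nonnegative, bounded, locally integrable inflow/outflow rates vanishing on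
`(−∞, 0)`, whose queue size `z(θ) = F⁺(θ − τ) − F⁻(θ)` is nonnegative, and such that for
almost every `θ`: `fo θ = ν` if `z θ > 0`, and `fo θ = min (fi (θ − τ)) ν` if `z θ = 0`. -/
def IsVickreyFlow (τ ν : ℝ) (fi fo : ℝ → ℝ) : Prop :=
  (∀ θ, 0 ≤ fi θ) ∧ (∀ θ, 0 ≤ fo θ) ∧
  (∃ M : ℝ, ∀ θ, fi θ ≤ M ∧ fo θ ≤ M) ∧
  LocallyIntegrable fi ∧ LocallyIntegrable fo ∧
  (∀ θ < (0:ℝ), fi θ = 0) ∧ (∀ θ < (0:ℝ), fo θ = 0) ∧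
  (∀ θ : ℝ, 0 ≤ cumul fi (θ - τ) - cumul fo θ) ∧
  (∀ᵐ θ : ℝ ∂volume,
    (0 < cumul fi (θ - τ) - cumul fo θ → fo θ = ν) ∧
    (cumul fi (θ - τ) - cumul fo θ = 0 → fo θ = min (fi (θ - τ)) ν))

theorem cumul_sub_cumul {f : ℝ → ℝ} (hf : LocallyIntegrable f) (a b : ℝ) :
    cumul f b - cumul f a = ∫ ξ in a..b, f ξ :=
  intervalIntegral.integral_interval_sub_left
    (hf.integrableOn_isCompact isCompact_uIcc).intervalIntegrable
    (hf.integrableOn_isCompact isCompact_uIcc).intervalIntegrable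

/-- The cumulative function of a nonnegative rate is nondecreasing. -/
theorem cumul_mono {f : ℝ → ℝ} (hf : LocallyIntegrable f) (h0 : ∀ θ, 0 ≤ f θ) :
    Monotone (cumul f) := fun a b hab => by
  rw [← sub_nonneg, cumul_sub_cumul hf]
  exact intervalIntegral.integral_nonneg hab fun ξ _ => h0 ξ

/-- A cumulative function grows at most linearly when its rate is bounded almost everywhere. -/
theorem cumul_sub_le {f : ℝ → ℝ} (hf : LocallyIntegrable f) {c : ℝ}
    (hc : ∀ᵐ θ : ℝ, f θ ≤ c) {a b : ℝ} (hab : a ≤ b) :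
    cumul f b - cumul f a ≤ c * (b - a) := by
  rw [cumul_sub_cumul hf]
  calc ∫ ξ in a..b, f ξ ≤ ∫ _ in a..b, c :=
        intervalIntegral.integral_mono_ae hab
          (hf.integrableOn_isCompact isCompact_uIcc).intervalIntegrable
          intervalIntegrable_const hc
    _ = c * (b - a) := by rw [intervalIntegral.integral_const, smul_eq_mul, mul_comm]

/-- The outflow rate of a Vickrey flow never exceeds the capacity, up to a null set. -/
theorem IsVickreyFlow.ae_outflow_le {τ ν : ℝ} {fi fo : ℝ → ℝ} (hV : IsVickreyFlow τ ν fi fo) :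
    ∀ᵐ θ : ℝ, fo θ ≤ ν := by
  obtain ⟨-, -, -, -, -, -, -, hz, hq⟩ := hV
  filter_upwards [hq] with θ hθ
  rcases (hz θ).lt_or_eq with h | h
  · exact (hθ.1 h).le
  · exact (hθ.2 h.symm).trans_le (min_le_right _ _)

/-- **FIFO.** The exit time function `T(θ) = θ + τ + z(θ + τ)/ν` of a Vickrey queue flow
is nondecreasing on `[0, ∞)`: flow particles traverse the arc in first-in-first-out
order. -/
theorem exit_time_monotone (τ ν : ℝ) (hτ : 0 < τ) (hν : 0 < ν)
    (fi fo : ℝ → ℝ) (hV : IsVickreyFlow τ ν fi fo)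
    (θ₁ θ₂ : ℝ) (hθ₁ : 0 ≤ θ₁) (h12 : θ₁ ≤ θ₂) :
    θ₁ + τ + (cumul fi θ₁ - cumul fo (θ₁ + τ)) / ν
      ≤ θ₂ + τ + (cumul fi θ₂ - cumul fo (θ₂ + τ)) / ν := by
  have hout := hV.ae_outflow_le
  obtain ⟨hfi, -, -, hfi_int, hfo_int, -⟩ := hV
  have hin := cumul_mono hfi_int hfi h12
  have hle := cumul_sub_le hfo_int hout (add_le_add_left h12 τ)
  have key : (cumul fi θ₁ - cumul fo (θ₁ + τ)) / ν
      ≤ (θ₂ - θ₁) + (cumul fi θ₂ - cumul fo (θ₂ + τ)) / ν := by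
    rw [div_le_iff₀ hν, add_mul, div_mul_cancel₀ _ hν.ne']
    linarith
  linarith
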